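/- arXiv:1406.1323 — 2 statements merged into one kernel-verified Lean document; each statement's English description precedes it below -/
import Mathlib

section
/- Let R be a commutative Noetherian ring, a and b ideals with b ⊆ a, and M a finitely generated R-module. For every non-negative integer n, one has f_a^b(M)_n ≤ f_a^b(M)^n, where f_a^b(M)_n = inf{i : dim Supp(b^t · H^i_a(M)) ≥ n for all t ∈ ℕ} and f_a^b(M)^n = inf{f_{aR_p}^{bR_p}(M_p) : p ∈ Spec(R), dim(R/p) ≥ n}. -/
open CategoryTheory

universe u

/-- Carrier of the `i`-th local cohomology module `H^i_a(M)` with support in `V(a)`. -/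
noncomputable def locH (R : Type u) [CommRing R] (a : Ideal R) (i : ℕ)
    (M : Type u) [AddCommGroup M] [Module R M] : ModuleCat R :=
  (localCohomology a i).obj (ModuleCat.of R M)

/-- Krull dimension of the support of a module. -/
noncomputable def dimSupp (R : Type u) [CommRing R]
    (M : Type u) [AddCommGroup M] [Module R M] : WithBot ℕ∞ :=
  Order.krullDim (Module.support R M)

/-- `f_a^b(M) = inf{i : b^n H^i_a(M) ≠ 0 for all n}`, the `b`-finiteness dimension
of `M` relative to `a` (`inf ∅ = ⊤`). -/
noncomputable def fab (R : Type u) [CommRing R] (a b : Ideal R)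
    (M : Type u) [AddCommGroup M] [Module R M] : ℕ∞ :=
  sInf ((↑) '' {i : ℕ |
    ∀ n : ℕ, b ^ n • (⊤ : Submodule R (locH R a i M)) ≠ ⊥})

/-- `f_a^b(M)_n = inf{i : dim Supp (b^t H^i_a(M)) ≥ n for all t}`. -/
noncomputable def fabn (R : Type u) [CommRing R] (a b : Ideal R)
    (M : Type u) [AddCommGroup M] [Module R M] (n : ℕ) : ℕ∞ :=
  sInf ((↑) '' {i : ℕ |
    ∀ t : ℕ, (n : WithBot ℕ∞) ≤ dimSupp R ↥(b ^ t • (⊤ : Submodule R (locH R a i M)))})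

/-- `f_a^b(M)^n = inf{f_{aR_p}^{bR_p}(M_p) : p ∈ Spec R, dim R/p ≥ n}`. -/
noncomputable def fabUpper (R : Type u) [CommRing R] (a b : Ideal R)
    (M : Type u) [AddCommGroup M] [Module R M] (n : ℕ) : ℕ∞ :=
  sInf {d : ℕ∞ | ∃ p : PrimeSpectrum R, (n : WithBot ℕ∞) ≤ ringKrullDim (R ⧸ p.asIdeal) ∧
    d = fab (Localization.AtPrime p.asIdeal)
      (a.map (algebraMap R (Localization.AtPrime p.asIdeal)))
      (b.map (algebraMap R (Localization.AtPrime p.asIdeal)))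
      (LocalizedModule p.asIdeal.primeCompl M)}

/-- `f_a(M) = inf{i : H^i_a(M) is not finitely generated}`, the finiteness dimension. -/
noncomputable def finDim (R : Type u) [CommRing R] (a : Ideal R)
    (M : Type u) [AddCommGroup M] [Module R M] : ℕ∞ :=
  sInf ((↑) '' {i : ℕ | ¬ Module.Finite R (locH R a i M)})

/-- The `i`-th Ext module `Ext^i_R(N, N')`. -/
noncomputable def extMod (R : Type u) [CommRing R] (i : ℕ)
    (N : Type u) [AddCommGroup N] [Module R N]
    (N' : Type u) [AddCommGroup N'] [Module R N'] : ModuleCat R :=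
  ((Ext R (ModuleCat.{u} R) i).obj (Opposite.op (ModuleCat.of R N))).obj (ModuleCat.of R N')

/-- `N` is `b`-cofinite: `Supp N ⊆ V(b)` and `Ext^i_R(R/b, N)` is finitely
generated for all `i ≥ 0`. -/
def IsCofinite (R : Type u) [CommRing R] (b : Ideal R)
    (N : Type u) [AddCommGroup N] [Module R N] : Prop :=
  Module.support R N ⊆ PrimeSpectrum.zeroLocus (b : Set R) ∧
    ∀ i : ℕ, Module.Finite R (extMod R i (R ⧸ b) N)

/-- `c_a^b(M) = inf{i : H^i_a(M) is not b-cofinite}`, the `b`-cofiniteness dimension. -/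
noncomputable def cofDim (R : Type u) [CommRing R] (a b : Ideal R)
    (M : Type u) [AddCommGroup M] [Module R M] : ℕ∞ :=
  sInf ((↑) '' {i : ℕ | ¬ IsCofinite R b (locH R a i M)})

/-- `depth(b, M)`: the supremum of lengths of `M`-regular sequences contained in `b`
(the common length of maximal `M`-regular sequences in `b`). -/
noncomputable def mdepth (R : Type u) [CommRing R] (b : Ideal R)
    (M : Type u) [AddCommGroup M] [Module R M] : ℕ∞ :=
  sSup {d : ℕ∞ | ∃ rs : List R, d = rs.length ∧ (∀ r ∈ rs, r ∈ b) ∧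
    RingTheory.Sequence.IsRegular M rs}

/-- `f_a^n(M) = inf{f_{aR_p}(M_p) : p ∈ Supp(M/aM), dim R/p ≥ n}`. -/
noncomputable def fan (R : Type u) [CommRing R] (a : Ideal R)
    (M : Type u) [AddCommGroup M] [Module R M] (n : ℕ) : ℕ∞ :=
  sInf {d : ℕ∞ | ∃ p : PrimeSpectrum R,
    p ∈ Module.support R (M ⧸ (a • ⊤ : Submodule R M)) ∧
    (n : WithBot ℕ∞) ≤ ringKrullDim (R ⧸ p.asIdeal) ∧
    d = finDim (Localization.AtPrime p.asIdeal)
      (a.map (algebraMap R (Localization.AtPrime p.asIdeal)))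
      (LocalizedModule p.asIdeal.primeCompl M)}

/-- `M` is in dimension `< n`: there is a finitely generated submodule `N ⊆ M`
with `dim Supp (M/N) < n`. -/
def InDimLT (R : Type u) [CommRing R] (n : ℕ)
    (M : Type u) [AddCommGroup M] [Module R M] : Prop :=
  ∃ N : Submodule R M, N.FG ∧ dimSupp R (M ⧸ N) < (n : WithBot ℕ∞)

section Helpers
open Limits


section ExtRep
variable {R : Type u} [CommRing R]

/-- The functor `Hom(-, Y)` into the opposite category. -/
noncomputable abbrev yonF (Y : ModuleCat.{u} R) : ModuleCat.{u} R ⥤ (ModuleCat.{u} R)ᵒᵖ :=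
  ((linearYoneda R (ModuleCat.{u} R)).obj Y).rightOp

/-- The complex `Hom(P, Y)` in the opposite category. -/
noncomputable def LC {X : ModuleCat.{u} R} (P : ProjectiveResolution X) (Y : ModuleCat.{u} R) :
    ChainComplex (ModuleCat.{u} R)ᵒᵖ ℕ :=
  ((yonF Y).mapHomologicalComplex _).obj P.complex

/-- The derived functor in terms of a resolution. -/
noncomputable def isoLC {X : ModuleCat.{u} R} (P : ProjectiveResolution X) (n : ℕ)
    (Y : ModuleCat.{u} R) : ((yonF Y).leftDerived n).obj X ≅ (LC P Y).homology n :=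
  P.isoLeftDerivedObj (yonF Y) n

/-- The map from cocycles to Ext. -/
noncomputable def clsMap {X : ModuleCat.{u} R} (P : ProjectiveResolution X) (n : ℕ)
    (Y : ModuleCat.{u} R) :
    ((LC P Y).opcycles n).unop ⟶ ((Ext R (ModuleCat.{u} R) n).obj (Opposite.op X)).obj Y :=
  ((isoLC P n Y).hom ≫ (LC P Y).homologyι n).unop

/-- The inclusion of cocycles into cochains. -/
noncomputable def toHom {X : ModuleCat.{u} R} (P : ProjectiveResolution X) (n : ℕ)
    (Y : ModuleCat.{u} R) :
    ((LC P Y).opcycles n).unop ⟶ ModuleCat.of R (P.complex.X n ⟶ Y) :=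
  ((LC P Y).pOpcycles n).unop

lemma clsMap_surj {X : ModuleCat.{u} R} (P : ProjectiveResolution X) (n : ℕ)
    (Y : ModuleCat.{u} R) : Function.Surjective (clsMap P n Y) := by
  have : Epi ((isoLC P n Y).hom ≫ (LC P Y).homologyι n).unop := inferInstance
  exact (ModuleCat.epi_iff_surjective _).1 this

lemma exists_toHom {X : ModuleCat.{u} R} (P : ProjectiveResolution X) (n : ℕ)
    (Y : ModuleCat.{u} R) (f : P.complex.X n ⟶ Y) (hf : P.complex.d (n+1) n ≫ f = 0) :
    ∃ z, toHom P n Y z = f := by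
  have h : (ShortComplex.mk ((LC P Y).d (n+1) n) ((LC P Y).pOpcycles n) (by simp)).Exact :=
    ShortComplex.exact_of_g_is_cokernel _ ((LC P Y).opcyclesIsCokernel (n+1) n (by simp))
  have h2 := h.unop
  rw [ShortComplex.ShortExact.moduleCat_exact_iff_function_exact] at h2
  exact (h2 f).1 hf

lemma d_toHom {X : ModuleCat.{u} R} (P : ProjectiveResolution X) (n : ℕ)
    (Y : ModuleCat.{u} R) (z) :
    P.complex.d (n+1) n ≫ (show P.complex.X n ⟶ Y from toHom P n Y z) = 0 := by
  have h : ((LC P Y).d (n+1) n) ≫ ((LC P Y).pOpcycles n) = 0 := by simp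
  have h2 := congrArg Quiver.Hom.unop h
  exact ConcreteCategory.congr_hom h2 z

lemma clsMap_zero {X : ModuleCat.{u} R} (P : ProjectiveResolution X) (n : ℕ)
    (Y : ModuleCat.{u} R) (z) (hz : clsMap P n Y z = 0) :
    ∃ (j : ℕ) (g : P.complex.X j ⟶ Y), toHom P n Y z = P.complex.d n j ≫ g := by
  let j := (ComplexShape.down ℕ).next n
  have h : (ShortComplex.mk ((LC P Y).homologyι n) ((LC P Y).fromOpcycles n j) (by simp)).Exact :=
    ShortComplex.exact_of_f_is_kernel _ ((LC P Y).homologyIsKernel n j rfl)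
  have h2 := h.unop
  rw [ShortComplex.ShortExact.moduleCat_exact_iff_function_exact] at h2
  have hz' : ((LC P Y).homologyι n).unop z = 0 := by
    have : ((isoLC P n Y).inv ≫ ((isoLC P n Y).hom ≫
      (LC P Y).homologyι n)).unop = ((LC P Y).homologyι n).unop := by simp
    rw [← this]
    change (isoLC P n Y).inv.unop (clsMap P n Y z) = 0
    rw [hz]; exact map_zero _
  obtain ⟨g, hg⟩ := (h2 z).1 hz'
  refine ⟨j, g, ?_⟩
  rw [← hg]
  have h3 := congrArg Quiver.Hom.unop ((LC P Y).p_fromOpcycles n j)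
  exact ConcreteCategory.congr_hom h3 g

lemma clsMap_boundary {X : ModuleCat.{u} R} (P : ProjectiveResolution X) (n : ℕ)
    (Y : ModuleCat.{u} R) (z) (j : ℕ) (g : P.complex.X j ⟶ Y)
    (hz : toHom P n Y z = P.complex.d n j ≫ g) : clsMap P n Y z = 0 := by
  have hinj : Function.Injective (toHom P n Y) := by
    have : Mono ((LC P Y).pOpcycles n).unop := inferInstance
    exact (ModuleCat.mono_iff_injective _).1 this
  have h3 := congrArg Quiver.Hom.unop ((LC P Y).p_fromOpcycles n j)
  have : z = ((LC P Y).fromOpcycles n j).unop g := by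
    apply hinj
    rw [hz]
    exact (ConcreteCategory.congr_hom h3 g).symm
  rw [this]
  have h4 : ((isoLC P n Y).hom ≫ (LC P Y).homologyι n) ≫ (LC P Y).fromOpcycles n j = 0 := by simp
  exact ConcreteCategory.congr_hom (congrArg Quiver.Hom.unop h4) g

lemma clsMap_natural {X X' : ModuleCat.{u} R} (h : X ⟶ X') (P : ProjectiveResolution X)
    (P' : ProjectiveResolution X') (φ : P.complex ⟶ P'.complex)
    (comm : φ.f 0 ≫ P'.π.f 0 = P.π.f 0 ≫ h) (n : ℕ)
    (Y : ModuleCat.{u} R) (z) :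
    ∃ z', toHom P n Y z' = φ.f n ≫ (show P'.complex.X n ⟶ Y from toHom P' n Y z) ∧
      clsMap P n Y z' = ((Ext R (ModuleCat.{u} R) n).map h.op).app Y (clsMap P' n Y z) := by
  let ψ : LC P Y ⟶ LC P' Y := ((yonF Y).mapHomologicalComplex _).map φ
  refine ⟨(HomologicalComplex.opcyclesMap ψ n).unop z, ?_, ?_⟩
  · have := congrArg Quiver.Hom.unop (HomologicalComplex.p_opcyclesMap ψ n)
    exact ConcreteCategory.congr_hom this z
  · have h1 : ((yonF Y).leftDerived n).map h ≫ (isoLC P' n Y).hom =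
      (isoLC P n Y).hom ≫ HomologicalComplex.homologyMap ψ n :=
      P.isoLeftDerivedObj_hom_naturality h P' φ comm (yonF Y) n
    have h2 : (((yonF Y).leftDerived n).map h ≫ (isoLC P' n Y).hom ≫
      (LC P' Y).homologyι n)
      = (isoLC P n Y).hom ≫ (LC P Y).homologyι n ≫
        HomologicalComplex.opcyclesMap ψ n := by
      rw [← HomologicalComplex.homologyι_naturality]
      rw [← Category.assoc, h1, Category.assoc]
    exact (ConcreteCategory.congr_hom (congrArg Quiver.Hom.unop h2) z).symm
end ExtRep


section LocRep
variable {R : Type u} [CommRing R]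
open localCohomology

/-- The `k`-th structure map into local cohomology. -/
noncomputable def locι (a : Ideal R) (i : ℕ) (M : ModuleCat.{u} R) (k : ℕ) :
    ((Ext R (ModuleCat.{u} R) i).obj (Opposite.op (ModuleCat.of R (R ⧸ a ^ k)))).obj M ⟶
      (localCohomology a i).obj M :=
  (colimit.ι (diagram (idealPowersDiagram a) i) (Opposite.op (Opposite.op k))).app M

/-- transition -/
def quotMap (a : Ideal R) {k l : ℕ} (h : k ≤ l) :
    ModuleCat.of R (R ⧸ a ^ l) ⟶ ModuleCat.of R (R ⧸ a ^ k) :=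
  ModuleCat.ofHom <| Submodule.mapQ _ _ LinearMap.id (Ideal.pow_le_pow_right h)

noncomputable def locIsColim (a : Ideal R) (i : ℕ) (M : ModuleCat.{u} R) :=
  isColimitOfPreserves ((evaluation _ _).obj M)
    (colimit.isColimit (diagram (idealPowersDiagram a) i))

instance pfc (J : Type) [SmallCategory J] [IsFiltered J] :
    PreservesColimitsOfShape J (forget (ModuleCat.{u} R)) := by
  have : PreservesFilteredColimitsOfSize.{0, 0} (forget (ModuleCat.{u} R)) :=
    preservesFilteredColimitsOfSize_shrink.{0, u, 0, u} _
  infer_instance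

lemma locι_surj (a : Ideal R) (i : ℕ) (M : ModuleCat.{u} R) (x : (localCohomology a i).obj M) :
    ∃ k y, locι a i M k y = x := by
  obtain ⟨j, y, hy⟩ := Concrete.isColimit_exists_rep _ (locIsColim a i M) x
  exact ⟨j.unop.unop, y, hy⟩

lemma locι_comp (a : Ideal R) (i : ℕ) (M : ModuleCat.{u} R) {k l : ℕ} (h : k ≤ l) (y) :
    locι a i M l (((Ext R (ModuleCat.{u} R) i).map (quotMap a h).op).app M y) = locι a i M k y := by
  have := colimit.w (diagram (idealPowersDiagram a) i)
    (show (Opposite.op (Opposite.op k) : ℕᵒᵖᵒᵖ) ⟶ Opposite.op (Opposite.op l) from (homOfLE h).op.op)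
  have h2 := congrArg (fun t => NatTrans.app t M) this
  exact ConcreteCategory.congr_hom h2 y

lemma locι_zero (a : Ideal R) (i : ℕ) (M : ModuleCat.{u} R) (k : ℕ) (y)
    (hy : locι a i M k y = 0) :
    ∃ (l : ℕ) (h : k ≤ l), ((Ext R (ModuleCat.{u} R) i).map (quotMap a h).op).app M y = 0 := by
  obtain ⟨j, f, g, hfg⟩ := Concrete.isColimit_exists_of_rep_eq
    (diagram (idealPowersDiagram a) i ⋙ (evaluation _ _).obj M) (locIsColim a i M)
    (i := Opposite.op (Opposite.op k)) (j := Opposite.op (Opposite.op k)) y 0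
    (by
      refine Eq.trans ?_ (map_zero (locι a i M k).hom).symm
      exact hy)
  refine ⟨j.unop.unop, f.unop.unop.le, ?_⟩
  refine Eq.trans hfg ?_
  exact map_zero (((diagram (idealPowersDiagram a) i ⋙ (evaluation _ _).obj M).map g).hom)
end LocRep


section FinRes
variable {R : Type u} [CommRing R]

lemma fg_projective [IsNoetherianRing R] (n : ℕ) :
    Projective (FGModuleCat.of R (ULift.{u} (Fin n) → R)) := by
  have : Projective (ModuleCat.of R (ULift.{u} (Fin n) → R)) :=
    ModuleCat.projective_of_categoryTheory_projective _
  constructor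
  intro E X f e he
  let G := forget₂ (FGModuleCat.{u} R) (ModuleCat.{u} R)
  have : Epi (G.map e) := inferInstance
  let f' : ModuleCat.of R (ULift.{u} (Fin n) → R) ⟶ G.obj X := G.map f
  let q0 : ModuleCat.of R (ULift.{u} (Fin n) → R) ⟶ G.obj E :=
    Projective.factorThru f' (G.map e)
  have hq0 : q0 ≫ G.map e = f' := Projective.factorThru_comp f' (G.map e)
  let q : G.obj (FGModuleCat.of R (ULift.{u} (Fin n) → R)) ⟶ G.obj E := q0
  refine ⟨G.preimage q, ?_⟩
  apply G.map_injective
  rw [G.map_comp, G.map_preimage]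
  exact hq0

lemma fg_cover [IsNoetherianRing R] (X : FGModuleCat.{u} R) :
    ∃ (n : ℕ) (f : FGModuleCat.of R (ULift.{u} (Fin n) → R) ⟶ X), Epi f := by
  obtain ⟨n, f, hf⟩ := Module.Finite.exists_fin' R X
  let e : (ULift.{u} (Fin n) → R) ≃ₗ[R] (Fin n → R) := LinearEquiv.funCongrLeft R R Equiv.ulift.symm
  let g : FGModuleCat.of R (ULift.{u} (Fin n) → R) ⟶ X := FGModuleCat.ofHom (f ∘ₗ e.toLinearMap)
  refine ⟨n, g, ?_⟩
  let G := forget₂ (FGModuleCat.{u} R) (ModuleCat.{u} R)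
  have : Epi (G.map g) := by
    rw [ModuleCat.epi_iff_surjective]
    exact hf.comp e.surjective
  exact G.epi_of_epi_map this

instance fg_enough [IsNoetherianRing R] : EnoughProjectives (FGModuleCat.{u} R) where
  presentation X := by
    obtain ⟨n, f, hf⟩ := fg_cover X
    have := fg_projective (R := R) n
    exact ⟨{ p := _, f := f }⟩

instance fg_pres [IsNoetherianRing R] :
    (forget₂ (FGModuleCat.{u} R) (ModuleCat.{u} R)).PreservesProjectiveObjects where
  projective_obj {X} hX := by
    obtain ⟨n, f, hf⟩ := fg_cover X
    have : Projective (ModuleCat.of R (ULift.{u} (Fin n) → R)) :=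
      ModuleCat.projective_of_categoryTheory_projective _
    let G := forget₂ (FGModuleCat.{u} R) (ModuleCat.{u} R)
    let r : Retract (G.obj X) (ModuleCat.of R (ULift.{u} (Fin n) → R)) :=
      { i := G.map (Projective.factorThru (𝟙 X) f)
        r := G.map f
        retract := by
          refine (G.map_comp (Projective.factorThru (𝟙 X) f) f).symm.trans ?_
          rw [Projective.factorThru_comp (𝟙 X) f, G.map_id] }
    exact r.projective

lemma exists_fin_res [IsNoetherianRing R] (X : ModuleCat.{u} R) [Module.Finite R X] :
    ∃ P : ProjectiveResolution X, ∀ n, Module.Finite R (P.complex.X n) := by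
  let Q := ProjectiveResolution.of (FGModuleCat.of R X)
  let G := forget₂ (FGModuleCat.{u} R) (ModuleCat.{u} R)
  exact ⟨G.mapProjectiveResolution Q, fun n => inferInstanceAs (Module.Finite R (Q.complex.X n))⟩

/-- Transport -/
noncomputable def resOfIso {X X' : ModuleCat.{u} R} (P : ProjectiveResolution X) (e : X ≅ X') :
    ProjectiveResolution X' where
  complex := P.complex
  π := P.π ≫ (ChainComplex.single₀ _).map e.hom
  quasiIso := inferInstance
end FinRes

section Loc
variable {R : Type u} [CommRing R] (S : Submonoid R)

/-- localization map -/
noncomputable abbrev lam (X : ModuleCat.{u} R) : X →ₗ[R] X.localizedModule S :=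
  X.localizedModuleMkLinearMap S

lemma unit_cancel {N : Type u} [AddCommGroup N] [Module (Localization S) N] (s : S) {x y : N}
    (h : algebraMap R (Localization S) s • x = algebraMap R (Localization S) s • y) : x = y :=
  (IsLocalization.map_units (Localization S) s).smul_left_cancel.1 h

lemma locExt {X : ModuleCat.{u} R} {N : ModuleCat.{u} (Localization S)}
    (p q : X.localizedModule S ⟶ N) (h : ∀ x, p (lam S X x) = q (lam S X x)) : p = q := by
  ext y
  obtain ⟨⟨x, s⟩, hx⟩ := IsLocalizedModule.surj S (lam S X) y
  have hx' : algebraMap R (Localization S) s • y = lam S X x := by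
    rw [algebraMap_smul]; exact hx
  apply unit_cancel S s
  have h1 := h x
  rw [← hx'] at h1
  exact ((map_smul p.hom _ y).symm.trans h1).trans (map_smul q.hom _ y)

/-- localization of a hom -/
noncomputable def locHom {X : ModuleCat.{u} R} {M : Type u} [AddCommGroup M] [Module R M]
    (g : X ⟶ ModuleCat.of R M) :
    X.localizedModule S ⟶ ModuleCat.of (Localization S) (LocalizedModule S M) :=
  ModuleCat.ofHom (IsLocalizedModule.mapExtendScalars S (lam S X)
    (LocalizedModule.mkLinearMap S M) (Localization S) g.hom)

lemma locHom_lam {X : ModuleCat.{u} R} {M : Type u} [AddCommGroup M] [Module R M]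
    (g : X ⟶ ModuleCat.of R M) (x : X) :
    locHom S g (lam S X x) = LocalizedModule.mkLinearMap S M (g x) :=
  IsLocalizedModule.map_apply S (lam S X) (LocalizedModule.mkLinearMap S M) g.hom x

lemma map_lam {X Y : ModuleCat.{u} R} (g : X ⟶ Y) (x : X) :
    (show X.localizedModule S ⟶ Y.localizedModule S from
      (ModuleCat.localizedModuleFunctor S).map g) (lam S X x) = lam S Y (g x) :=
  IsLocalizedModule.map_apply S (lam S X) (lam S Y) g.hom x

lemma locHom_comp {X Y : ModuleCat.{u} R} {M : Type u} [AddCommGroup M] [Module R M]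
    (d : X ⟶ Y) (g : Y ⟶ ModuleCat.of R M) :
    locHom S (d ≫ g) = (show X.localizedModule S ⟶ Y.localizedModule S from
      (ModuleCat.localizedModuleFunctor S).map d) ≫ locHom S g := by
  apply locExt
  intro x
  rw [locHom_lam]
  refine Eq.trans ?_ (congrArg (locHom S g) (map_lam S d x)).symm
  rw [locHom_lam]; rfl

lemma locHom_smul {X : ModuleCat.{u} R} {M : Type u} [AddCommGroup M] [Module R M]
    (r : R) (g : X ⟶ ModuleCat.of R M) :
    locHom S (r • g) = algebraMap R (Localization S) r • locHom S g := by
  apply locExt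
  intro x
  rw [locHom_lam]
  refine Eq.trans (map_smul (LocalizedModule.mkLinearMap S M) r (g x)) ?_
  rw [← locHom_lam]
  exact (algebraMap_smul (Localization S) r _).symm

lemma locHom_lift [IsNoetherianRing R] {X : ModuleCat.{u} R} [Module.Finite R X]
    {M : Type u} [AddCommGroup M] [Module R M]
    (f : X.localizedModule S ⟶ ModuleCat.of (Localization S) (LocalizedModule S M)) :
    ∃ (s : S) (g : X ⟶ ModuleCat.of R M),
      locHom S g = algebraMap R (Localization S) s • f := by
  have : Module.FinitePresentation R X := Module.finitePresentation_of_finite R X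
  obtain ⟨⟨g, s⟩, hg⟩ := IsLocalizedModule.surj S (IsLocalizedModule.mapExtendScalars S (lam S X)
    (LocalizedModule.mkLinearMap S M) (Localization S)) f.hom
  refine ⟨s, ModuleCat.ofHom g, ?_⟩
  apply locExt
  intro x
  have := (LinearMap.congr_fun hg (lam S X x)).symm
  exact this.trans (algebraMap_smul (Localization S) (s : R) (f.hom (lam S X x))).symm

lemma locHom_zero [IsNoetherianRing R] {X : ModuleCat.{u} R} [Module.Finite R X]
    {M : Type u} [AddCommGroup M] [Module R M]
    (g : X ⟶ ModuleCat.of R M) (h : locHom S g = 0) : ∃ s : S, (s : R) • g = 0 := by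
  have : Module.FinitePresentation R X := Module.finitePresentation_of_finite R X
  have h' : IsLocalizedModule.mapExtendScalars S (lam S X)
    (LocalizedModule.mkLinearMap S M) (Localization S) g.hom = 0 := congrArg ModuleCat.Hom.hom h
  obtain ⟨s, hs⟩ := (IsLocalizedModule.eq_zero_iff S (IsLocalizedModule.mapExtendScalars S (lam S X)
    (LocalizedModule.mkLinearMap S M) (Localization S))).1 h'
  exact ⟨s, ModuleCat.hom_ext hs⟩

lemma modIso (X : ModuleCat.{u} R) (T : Type u) [AddCommGroup T] [Module R T]
    [Module (Localization S) T] [IsScalarTower R (Localization S) T] (f : X →ₗ[R] T)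
    [IsLocalizedModule S f] :
    ∃ e : X.localizedModule S ≅ ModuleCat.of (Localization S) T,
      ∀ x, e.hom (lam S X x) = f x := by
  let e1 := IsLocalizedModule.linearEquiv S (lam S X) f
  let e2 := e1.extendScalarsOfIsLocalization S (Localization S)
  refine ⟨e2.toModuleIso, fun r => ?_⟩
  exact IsLocalizedModule.linearEquiv_apply S (lam S X) f _

lemma quotIso (I : Ideal R) (J : Ideal (Localization S))
    (hJ : J = I.map (algebraMap R (Localization S))) :
    ∃ e : (ModuleCat.of R (R ⧸ I)).localizedModule S ≅ ModuleCat.of (Localization S)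
        (Localization S ⧸ J), ∀ r : R, e.hom (lam S (ModuleCat.of R (R ⧸ I)) (Ideal.Quotient.mk I r))
          = Ideal.Quotient.mk J (algebraMap R (Localization S) r) := by
  have hJ' : J = Submodule.localized' (Localization S) S (Algebra.linearMap R (Localization S)) I :=
    hJ.trans (Ideal.localized'_eq_map (Localization S) S I).symm
  subst hJ'
  obtain ⟨e, he⟩ := modIso S (ModuleCat.of R (R ⧸ I)) _ (Submodule.toLocalizedQuotient'
    (Localization S) S (Algebra.linearMap R (Localization S)) I)
  exact ⟨e, fun r => he (Ideal.Quotient.mk I r)⟩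

/-- The localized resolution. -/
noncomputable def locRes {Z : ModuleCat.{u} R} (P : ProjectiveResolution Z)
    {Z' : ModuleCat.{u} (Localization S)} (e : Z.localizedModule S ≅ Z') :
    ProjectiveResolution Z' :=
  resOfIso ((ModuleCat.localizedModuleFunctor S).mapProjectiveResolution P) e

lemma locRes_comm {X Y : ModuleCat.{u} R} (P : ProjectiveResolution X) (Q : ProjectiveResolution Y)
    {X' Y' : ModuleCat.{u} (Localization S)} (e : X.localizedModule S ≅ X')
    (e' : Y.localizedModule S ≅ Y') (h : X ⟶ Y) (h' : X' ⟶ Y')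
    (hh : (show X.localizedModule S ⟶ Y.localizedModule S from
      (ModuleCat.localizedModuleFunctor S).map h) ≫ e'.hom = e.hom ≫ h')
    (φ : P.complex ⟶ Q.complex) (hφ : φ ≫ Q.π = P.π ≫ (ChainComplex.single₀ _).map h) :
    (show (locRes S P e).complex ⟶ (locRes S Q e').complex from
      ((ModuleCat.localizedModuleFunctor S).mapHomologicalComplex _).map φ).f 0 ≫
      (locRes S Q e').π.f 0 = (locRes S P e).π.f 0 ≫ h' := by
  let F := ModuleCat.localizedModuleFunctor.{u} S
  let e1 : F.obj X ⟶ X' := e.hom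
  let e1' : F.obj Y ⟶ Y' := e'.hom
  have hh1 : F.map h ≫ e1' = e1 ≫ h' := hh
  have key : (F.mapHomologicalComplex _).map φ ≫
     (((F.mapHomologicalComplex _).map Q.π ≫
      (HomologicalComplex.singleMapHomologicalComplex F (ComplexShape.down ℕ) 0).hom.app Y) ≫
      (ChainComplex.single₀ _).map e1') = (((F.mapHomologicalComplex _).map P.π ≫
      (HomologicalComplex.singleMapHomologicalComplex F (ComplexShape.down ℕ) 0).hom.app X) ≫
      (ChainComplex.single₀ _).map e1) ≫ (ChainComplex.single₀ _).map h' := by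
    have n1 := (HomologicalComplex.singleMapHomologicalComplex F
      (ComplexShape.down ℕ) 0).hom.naturality h
    simp only [Category.assoc]
    rw [← Functor.map_comp (ChainComplex.single₀ _) e1 h', ← hh1, Functor.map_comp]
    have n2 := congrArg ((F.mapHomologicalComplex _).map) hφ
    rw [Functor.map_comp, Functor.map_comp] at n2
    rw [reassoc_of% n2]
    congr 1
    exact (reassoc_of% n1) _
  have k0 := congrArg (fun t => HomologicalComplex.Hom.f t 0) key
  exact k0
end Loc

section Key
variable {R : Type u} [CommRing R] (S : Submonoid R)

lemma smul3_cancel {N : Type u} [AddCommGroup N] [Module (Localization S) N] (s s1 : S)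
    (c : Localization S) (x : N) (hx : c • algebraMap R (Localization S) s1 •
      algebraMap R (Localization S) s • x = 0) : c • x = 0 := by
  apply unit_cancel S s
  apply unit_cancel S s1
  rw [smul_zero, smul_zero]
  refine Eq.trans ?_ hx
  rw [smul_smul, smul_smul, smul_smul, smul_smul]
  congr 1
  ring

lemma quot_comm (a : Ideal R) {k l : ℕ} (h : k ≤ l)
   (e : (ModuleCat.of R (R ⧸ a^l)).localizedModule S ≅ ModuleCat.of (Localization S)
        (Localization S ⧸ (a.map (algebraMap R (Localization S)))^l))
   (he : ∀ r : R, e.hom (lam S (ModuleCat.of R (R ⧸ a^l)) (Ideal.Quotient.mk (a^l) r))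
          = Ideal.Quotient.mk _ (algebraMap R (Localization S) r))
   (e' : (ModuleCat.of R (R ⧸ a^k)).localizedModule S ≅ ModuleCat.of (Localization S)
        (Localization S ⧸ (a.map (algebraMap R (Localization S)))^k))
   (he' : ∀ r : R, e'.hom (lam S (ModuleCat.of R (R ⧸ a^k)) (Ideal.Quotient.mk (a^k) r))
          = Ideal.Quotient.mk _ (algebraMap R (Localization S) r)) :
   (show (ModuleCat.of R (R ⧸ a^l)).localizedModule S ⟶ 
      (ModuleCat.of R (R ⧸ a^k)).localizedModule S from
      (ModuleCat.localizedModuleFunctor S).map (quotMap a h)) ≫ e'.hom = e.hom ≫ quotMap _ h := by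
  apply locExt
  intro x
  obtain ⟨r, rfl⟩ := Ideal.Quotient.mk_surjective (I := a^l) x
  have h1 := congrArg e'.hom (map_lam S (quotMap a h) (Ideal.Quotient.mk (a^l) r))
  refine h1.trans ((he' r).trans ?_)
  exact (congrArg (quotMap (a.map (algebraMap R (Localization S))) h) (he r)).symm

/-- Elements of localized local cohomology lift. -/
lemma key [IsNoetherianRing R] (a : Ideal R) (M : Type u) [AddCommGroup M] [Module R M] (i : ℕ)
    (x : locH (Localization S) (a.map (algebraMap R (Localization S))) i (LocalizedModule S M)) :
    ∃ y : locH R a i M, ∀ c : R, c • y = 0 → algebraMap R (Localization S) c • x = 0 := by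
  let A := Localization S
  let a' := a.map (algebraMap R A)
  have hres : ∀ k, ∃ P : ProjectiveResolution (ModuleCat.of R (R ⧸ a^k)),
      ∀ n, Module.Finite R (P.complex.X n) := fun k => exists_fin_res _
  choose P hP using hres
  have hiso : ∀ k, ∃ e : (ModuleCat.of R (R ⧸ a^k)).localizedModule S ≅ ModuleCat.of A
        (A ⧸ a'^k), ∀ r : R, e.hom (lam S (ModuleCat.of R (R ⧸ a^k)) (Ideal.Quotient.mk (a^k) r))
          = Ideal.Quotient.mk (a'^k) (algebraMap R A r) := fun k =>
    quotIso S (a^k) (a'^k) (Ideal.map_pow _ _ _).symm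
  choose e he using hiso
  let N := ModuleCat.of A (LocalizedModule S M)
  obtain ⟨k, ξ, rfl⟩ := locι_surj a' i N x
  let Q := fun k => locRes S (P k) (e k)
  obtain ⟨z, rfl⟩ := clsMap_surj (Q k) i N ξ
  let f : ((P k).complex.X i).localizedModule S ⟶ N := toHom (Q k) i N z
  have hf : (show ((P k).complex.X (i+1)).localizedModule S ⟶ 
      ((P k).complex.X i).localizedModule S from
      (ModuleCat.localizedModuleFunctor S).map ((P k).complex.d (i+1) i)) ≫ f = 0 :=
    d_toHom (Q k) i N z
  have := hP k i
  have := hP k (i+1)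
  obtain ⟨s, g, hg⟩ := locHom_lift S f
  have h0 : locHom S ((P k).complex.d (i+1) i ≫ g) = 0 := by
    rw [locHom_comp, hg, Linear.comp_smul, hf, smul_zero]
  obtain ⟨s1, hs1⟩ := locHom_zero S _ h0
  obtain ⟨w, hw⟩ := exists_toHom (P k) i (ModuleCat.of R M) ((s1 : R) • g) (by
    rw [Linear.comp_smul, hs1])
  refine ⟨locι a i (ModuleCat.of R M) k (clsMap (P k) i _ w), fun c hc => ?_⟩
  have hc1 : locι a i (ModuleCat.of R M) k (clsMap (P k) i _ (c • w)) = 0 := by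
    refine Eq.trans ?_ hc
    rw [map_smul]
    exact map_smul (locι a i (ModuleCat.of R M) k).hom c _
  obtain ⟨l, hkl, hl⟩ := locι_zero a i _ k _ hc1
  let φ := ProjectiveResolution.lift (quotMap a hkl) (P l) (P k)
  have hφ : φ ≫ (P k).π = (P l).π ≫ (ChainComplex.single₀ _).map (quotMap a hkl) :=
    ProjectiveResolution.lift_commutes _ _ _
  have hφ0 : φ.f 0 ≫ (P k).π.f 0 = (P l).π.f 0 ≫ quotMap a hkl :=
    congrArg (fun t => HomologicalComplex.Hom.f t 0) hφ
  obtain ⟨w', hw', hw'2⟩ := clsMap_natural (quotMap a hkl) (P l) (P k) φ hφ0 i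
    (ModuleCat.of R M) (c • w)
  obtain ⟨j, g', hg'⟩ := clsMap_zero _ _ _ w' (hw'2.trans hl)
  have e1 : φ.f i ≫ (c • (s1 : R) • g) = (P l).complex.d i j ≫ g' := by
    have e2 : toHom (P k) i (ModuleCat.of R M) (c • w) = c • (s1 : R) • g := by
      rw [map_smul, hw]
    rw [← hg', hw', e2]
  have e3 := congrArg (locHom S) e1
  rw [locHom_comp, locHom_comp, locHom_smul, locHom_smul, hg] at e3
  let α := algebraMap R A
  let ψ : (Q l).complex ⟶ (Q k).complex :=
    ((ModuleCat.localizedModuleFunctor S).mapHomologicalComplex _).map φ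
  have hψ : ψ.f 0 ≫ (Q k).π.f 0 = (Q l).π.f 0 ≫ quotMap a' hkl :=
    locRes_comm S (P l) (P k) (e l) (e k) (quotMap a hkl) (quotMap a' hkl)
      (quot_comm S a hkl (e l) (he l) (e k) (he k)) φ hφ
  obtain ⟨v, hv, hv2⟩ := clsMap_natural (quotMap a' hkl) (Q l) (Q k) ψ hψ i N
    (α c • α s1 • α s • z)
  have hv0 : clsMap (Q l) i N v = 0 := by
    refine clsMap_boundary (Q l) i N v j (locHom S g') ?_
    have e4 : toHom (Q k) i N (α c • α s1 • α s • z) = α c • α s1 • α s • f := by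
      rw [map_smul, map_smul, map_smul]; rfl
    rw [hv, e4]
    exact e3
  rw [hv0] at hv2
  have hx : locι a' i N k (clsMap (Q k) i N (α c • α s1 • α s • z)) = 0 := by
    rw [← locι_comp a' i N hkl, ← hv2, map_zero]
  rw [map_smul, map_smul, map_smul, map_smul, map_smul, map_smul] at hx
  exact smul3_cancel S s s1 (α c) _ hx

lemma key2 [IsNoetherianRing R] (a b : Ideal R) (M : Type u) [AddCommGroup M] [Module R M]
    (i t : ℕ) (h : ∀ y ∈ (b ^ t • (⊤ : Submodule R (locH R a i M))), ∃ s : S, (s : R) • y = 0) :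
    (b.map (algebraMap R (Localization S))) ^ t • (⊤ : Submodule (Localization S)
      (locH (Localization S) (a.map (algebraMap R (Localization S))) i (LocalizedModule S M)))
      = ⊥ := by
  rw [← Ideal.map_pow, eq_bot_iff, Submodule.smul_le]
  intro r hr x _
  rw [Submodule.mem_bot]
  have hle : (b ^ t).map (algebraMap R (Localization S)) ≤
      LinearMap.ker (LinearMap.toSpanSingleton (Localization S) _ x) := by
    rw [Ideal.map_le_iff_le_comap]
    intro c hc
    obtain ⟨y, hy⟩ := key S a M i x
    obtain ⟨s, hs⟩ := h (c • y) (Submodule.smul_mem_smul hc trivial)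
    rw [smul_smul] at hs
    have h1 := hy _ hs
    rw [map_mul, mul_smul] at h1
    refine unit_cancel S s ?_
    rw [smul_zero]
    exact h1
  exact hle hr

lemma dimSupp_ge (N : Type u) [AddCommGroup N] [Module R N] (p : PrimeSpectrum R)
    (hp : p ∈ Module.support R N) : ringKrullDim (R ⧸ p.asIdeal) ≤ dimSupp R N := by
  have hle : ∀ q : PrimeSpectrum (R ⧸ p.asIdeal),
      PrimeSpectrum.comap (Ideal.Quotient.mk p.asIdeal) q ∈ Module.support R N := by
    intro q
    refine Module.mem_support_mono ?_ hp
    intro x hx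
    change Ideal.Quotient.mk p.asIdeal x ∈ q.asIdeal
    rw [Ideal.Quotient.eq_zero_iff_mem.2 hx]
    exact zero_mem _
  let F : PrimeSpectrum (R ⧸ p.asIdeal) → Module.support R N := fun q => ⟨_, hle q⟩
  refine Order.krullDim_le_of_strictMono F ?_
  have hm : Monotone F := fun q q' h => by
    exact Ideal.comap_mono (f := Ideal.Quotient.mk p.asIdeal) h
  refine hm.strictMono_of_injective ?_
  intro q q' h
  exact PrimeSpectrum.comap_injective_of_surjective _ Ideal.Quotient.mk_surjective
    (Subtype.ext_iff.1 h)
end Key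

end Helpers

/-- `f_a^b(M)_n ≤ f_a^b(M)^n`. -/
theorem fabn_le_fabUpper (R : Type u) [CommRing R] [IsNoetherianRing R]
    (a b : Ideal R) (hba : b ≤ a)
    (M : Type u) [AddCommGroup M] [Module R M] [Module.Finite R M] (n : ℕ) :
    fabn R a b M n ≤ fabUpper R a b M n := by
  refine le_sInf ?_
  rintro d ⟨p, hp, rfl⟩
  refine le_sInf ?_
  rintro _ ⟨i, hi, rfl⟩
  refine sInf_le ⟨i, fun t => ?_, rfl⟩
  refine hp.trans (dimSupp_ge _ p ?_)
  by_contra hns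
  rw [Module.notMem_support_iff'] at hns
  refine hi t (key2 p.asIdeal.primeCompl a b M i t ?_)
  intro y hy
  obtain ⟨r, hr, hr2⟩ := hns ⟨y, hy⟩
  exact ⟨⟨r, hr⟩, congrArg Subtype.val hr2⟩
end

section
/- Let R be a commutative Noetherian ring, a and b ideals with b ⊆ a, and M a finitely generated R-module such that Ass_R(H_a^{f_a^b(M)}(M)) is a finite set. Then f_a^b(M) = inf{f_{aR_p}^{bR_p}(M_p) : p ∈ Spec(R)}. -/
open CategoryTheory

universe u

section Helpers

open CategoryTheory.Limits

theorem leftDerived_delta {C D : Type*} [Category* C] [Category* D] [Abelian C]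
    [HasProjectiveResolutions C] [Abelian D] {F G H : C ⥤ D} [F.Additive] [G.Additive] [H.Additive]
    (α : F ⟶ G) (β : G ⟶ H) (w : ∀ X, α.app X ≫ β.app X = 0)
    (hS : ∀ X : C, Projective X → (ShortComplex.mk (α.app X) (β.app X) (w X)).ShortExact) (n : ℕ) :
    ∃ δ : H.leftDerived (n + 1) ⟶ F.leftDerived n, 
      (∀ X, ∃ w, (ShortComplex.mk ((NatTrans.leftDerived β (n + 1)).app X) (δ.app X) w).Exact) ∧
      (∀ X, ∃ w, (ShortComplex.mk (δ.app X) ((NatTrans.leftDerived α n).app X) w).Exact) := by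
  let c := ComplexShape.down ℕ
  have hc : c.Rel (n+1) n := by simp [c]
  let T : ChainComplex C ℕ → ShortComplex (ChainComplex D ℕ) := fun P =>
    ShortComplex.mk ((NatTrans.mapHomologicalComplex α c).app P)
      ((NatTrans.mapHomologicalComplex β c).app P) (by ext i; exact w _)
  have hT : ∀ X : C, (T (projectiveResolution X).complex).ShortExact := by
    intro X
    apply HomologicalComplex.shortExact_of_degreewise_shortExact
    intro i
    exact hS _ ((projectiveResolution X).projective i)
  obtain ⟨d, d1, d2, d3⟩ : ∃ d : ∀ X : C, (HomologicalComplex.homologyFunctor D (ComplexShape.down ℕ) (n+1)).obj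
        ((H.mapHomologicalComplex (ComplexShape.down ℕ)).obj (projectiveResolution X).complex) ⟶
        (HomologicalComplex.homologyFunctor D (ComplexShape.down ℕ) n).obj
        ((F.mapHomologicalComplex (ComplexShape.down ℕ)).obj (projectiveResolution X).complex),
        (∀ (X Y : C) (φ : (projectiveResolution X).complex ⟶ (projectiveResolution Y).complex),
          d X ≫ (F.mapHomologicalComplex (ComplexShape.down ℕ) ⋙ HomologicalComplex.homologyFunctor D (ComplexShape.down ℕ) n).map φ =
          (H.mapHomologicalComplex (ComplexShape.down ℕ) ⋙ HomologicalComplex.homologyFunctor D (ComplexShape.down ℕ) (n+1)).map φ ≫ d Y) ∧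
        (∀ X : C, ∃ w, (ShortComplex.mk ((HomologicalComplex.homologyFunctor D (ComplexShape.down ℕ) (n+1)).map
          ((NatTrans.mapHomologicalComplex β (ComplexShape.down ℕ)).app (projectiveResolution X).complex)) (d X) w).Exact) ∧
        (∀ X : C, ∃ w, (ShortComplex.mk (d X) ((HomologicalComplex.homologyFunctor D (ComplexShape.down ℕ) n).map
          ((NatTrans.mapHomologicalComplex α (ComplexShape.down ℕ)).app (projectiveResolution X).complex)) w).Exact) := by
    refine ⟨fun X => (hT X).δ (n+1) n hc, fun X Y φ => ?_, fun X => ?_, fun X => ?_⟩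
    · let Φ : T (projectiveResolution X).complex ⟶ T (projectiveResolution Y).complex :=
          { τ₁ := (F.mapHomologicalComplex c).map φ
            τ₂ := (G.mapHomologicalComplex c).map φ
            τ₃ := (H.mapHomologicalComplex c).map φ
            comm₁₂ := by ext i; exact (α.naturality (φ.f i))
            comm₂₃ := by ext i; exact (β.naturality (φ.f i)) }
      exact HomologicalComplex.HomologySequence.δ_naturality Φ (hT X) (hT Y) (n+1) n hc
    · exact ⟨_, (hT X).homology_exact₃ (n+1) n hc⟩
    · exact ⟨_, (hT X).homology_exact₁ (n+1) n hc⟩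
  clear hT T
  let δ : H.leftDerived (n + 1) ⟶ F.leftDerived n :=
    { app := fun X => ((projectiveResolution X).isoLeftDerivedObj H (n+1)).hom ≫ 
        d X ≫ ((projectiveResolution X).isoLeftDerivedObj F n).inv
      naturality := by
        intro X Y f
        let φ := ProjectiveResolution.lift f (projectiveResolution X) (projectiveResolution Y)
        have comm : φ.f 0 ≫ (projectiveResolution Y).π.f 0 = (projectiveResolution X).π.f 0 ≫ f :=
          ProjectiveResolution.lift_commutes_zero _ _ _
        have e1 := ProjectiveResolution.isoLeftDerivedObj_hom_naturality f _ _ φ comm H (n+1)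
        have e2 := ProjectiveResolution.isoLeftDerivedObj_inv_naturality f _ _ φ comm F n
        have e3 := d1 X Y φ
        rw [reassoc_of% e1, Category.assoc, Category.assoc, e2]
        congr 1
        exact (reassoc_of% e3.symm) _ }
  refine ⟨δ, fun X => ?_, fun X => ?_⟩
  · have e := (projectiveResolution X).leftDerived_app_eq β (n+1)
    obtain ⟨w1, h1⟩ := d2 X
    have w0 : (NatTrans.leftDerived β (n + 1)).app X ≫ δ.app X = 0 := by
      rw [e]
      simp only [δ, Category.assoc, Iso.inv_hom_id_assoc]
      rw [reassoc_of% w1]; simp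
    refine ⟨w0, ?_⟩
    refine (ShortComplex.exact_iff_of_iso ?_).1 h1
    refine ShortComplex.isoMk ((projectiveResolution X).isoLeftDerivedObj G (n+1)).symm
      ((projectiveResolution X).isoLeftDerivedObj H (n+1)).symm
      ((projectiveResolution X).isoLeftDerivedObj F n).symm ?_ ?_
    · dsimp only [Iso.symm_hom]
      rw [e, Iso.inv_hom_id_assoc]
    · dsimp only [Iso.symm_hom, δ]
      rw [Iso.inv_hom_id_assoc]
  · have e := (projectiveResolution X).leftDerived_app_eq α n
    obtain ⟨w1, h1⟩ := d3 X
    have w0 : δ.app X ≫ (NatTrans.leftDerived α n).app X = 0 := by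
      rw [e]
      simp only [δ, Category.assoc, Iso.inv_hom_id_assoc]
      rw [reassoc_of% w1]; simp
    refine ⟨w0, ?_⟩
    refine (ShortComplex.exact_iff_of_iso ?_).1 h1
    refine ShortComplex.isoMk ((projectiveResolution X).isoLeftDerivedObj H (n+1)).symm
      ((projectiveResolution X).isoLeftDerivedObj F n).symm
      ((projectiveResolution X).isoLeftDerivedObj G n).symm ?_ ?_
    · dsimp only [Iso.symm_hom, δ]
      rw [Iso.inv_hom_id_assoc]
    · dsimp only [Iso.symm_hom]
      rw [e, Iso.inv_hom_id_assoc]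



theorem ext_injective_zero {R : Type u} [CommRing R] (N I : ModuleCat.{u} R) [Injective I] (n : ℕ) :
    IsZero (((Ext R (ModuleCat.{u} R) (n + 1)).obj (Opposite.op N)).obj I) := by
  let P := projectiveResolution N
  refine IsZero.of_iso ?_ (P.isoExt (n + 1) I)
  rw [← HomologicalComplex.exactAt_iff_isZero_homology,
    HomologicalComplex.exactAt_iff' _ n (n+1) (n+2) (by simp) (by simp)]
  rw [ShortComplex.moduleCat_exact_iff]
  intro x hx
  have hex := P.exact_succ n
  have hx' : P.complex.d (n+2) (n+1) ≫ (show P.complex.X (n+1) ⟶ I from x) = 0 := hx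
  exact ⟨hex.descToInjective (show P.complex.X (n+1) ⟶ I from x) hx', hex.comp_descToInjective _ _⟩

theorem ext_delta {R : Type u} [CommRing R] (S : ShortComplex (ModuleCat.{u} R)) (hS : S.ShortExact)
    [Injective S.X₂] (n : ℕ) :
    ∃ δ : (Ext R (ModuleCat.{u} R) n).flip.obj S.X₃ ⟶ (Ext R (ModuleCat.{u} R) (n+1)).flip.obj S.X₁,
      ∀ N : (ModuleCat.{u} R)ᵒᵖ, Function.Surjective (δ.app N) ∧ 
        Function.Exact (((Ext R (ModuleCat.{u} R) n).obj N).map S.g) (δ.app N) := by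
  let Y := linearYoneda R (ModuleCat.{u} R)
  have w : ∀ X : ModuleCat.{u} R, (Y.map S.g).rightOp.app X ≫ (Y.map S.f).rightOp.app X = 0 := by
    intro X
    apply Quiver.Hom.unop_inj
    ext (x : X ⟶ _)
    change (x ≫ S.f) ≫ S.g = 0
    simp
  obtain ⟨δ, h1, h2⟩ := leftDerived_delta (NatTrans.rightOp (Y.map S.g)) (NatTrans.rightOp (Y.map S.f)) w (by
    intro X hX
    refine ShortComplex.ShortExact.op (S := ShortComplex.mk ((Y.map S.f).app (Opposite.op X)) ((Y.map S.g).app (Opposite.op X)) (congrArg Quiver.Hom.unop (w X))) ?_ 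
    have := hS.mono_f
    have := hS.epi_g
    refine { exact := ?_, mono_f := ?_, epi_g := ?_ }
    · rw [ShortComplex.moduleCat_exact_iff]
      intro x hx
      exact ⟨hS.exact.lift (show X ⟶ S.X₂ from x) hx, hS.exact.lift_f _ _⟩
    · rw [ModuleCat.mono_iff_injective]
      intro x y hxy
      have : (show X ⟶ S.X₁ from x) ≫ S.f = (show X ⟶ S.X₁ from y) ≫ S.f := hxy
      exact (cancel_mono S.f).1 this
    · rw [ModuleCat.epi_iff_surjective]
      intro x
      exact ⟨Projective.factorThru (show X ⟶ S.X₃ from x) S.g, Projective.factorThru_comp (show X ⟶ S.X₃ from x) S.g⟩) n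
  refine ⟨NatTrans.leftOp δ, fun N => ⟨?_, ?_⟩⟩
  · obtain ⟨w1, h⟩ := h1 N.unop
    have h := h.unop
    rw [ShortComplex.moduleCat_exact_iff] at h
    intro x
    have hz := ext_injective_zero N.unop S.X₂ n
    exact h x (@Subsingleton.elim _ (ModuleCat.subsingleton_of_isZero hz) _ _)
  · obtain ⟨w1, h⟩ := h2 N.unop
    have h := h.unop
    intro x
    constructor
    · rw [ShortComplex.moduleCat_exact_iff] at h
      exact h x
    · rintro ⟨y, rfl⟩
      exact ConcreteCategory.congr_hom (congrArg Quiver.Hom.unop w1) y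

instance forgetModFilt {R : Type u} [CommRing R] :
    PreservesFilteredColimitsOfSize.{0, 0} (forget (ModuleCat.{u} R)) :=
  preservesFilteredColimitsOfSize_shrink.{0, u, 0, u} _

instance forgetModNat {R : Type u} [CommRing R] :
    PreservesColimitsOfShape ℕᵒᵖᵒᵖ (forget (ModuleCat.{u} R)) :=
  PreservesFilteredColimitsOfSize.preserves_filtered_colimits _

open localCohomology in
/-- evaluated cocone -/
noncomputable def lcCocone {R : Type u} [CommRing R] (a : Ideal R) (i : ℕ) (M : ModuleCat.{u} R) :
    Cocone (diagram (idealPowersDiagram a) i ⋙ (evaluation _ _).obj M) :=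
  have := hasColimitDiagram.{u, 0} (idealPowersDiagram a) i
  ((evaluation _ _).obj M).mapCocone (colimit.cocone (diagram (idealPowersDiagram a) i))

open localCohomology in
noncomputable def lcIsColimit {R : Type u} [CommRing R] (a : Ideal R) (i : ℕ) (M : ModuleCat.{u} R) :
    IsColimit (lcCocone a i M) :=
  have := hasColimitDiagram.{u, 0} (idealPowersDiagram a) i
  isColimitOfPreserves ((evaluation _ _).obj M) (colimit.isColimit _)

theorem lcCocone_pt {R : Type u} [CommRing R] (a : Ideal R) (i : ℕ) (M : ModuleCat.{u} R) :
    (lcCocone a i M).pt = (localCohomology a i).obj M := rfl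

open localCohomology in
theorem lcCocone_nat {R : Type u} [CommRing R] (a : Ideal R) (i : ℕ) {M N : ModuleCat.{u} R} (f : M ⟶ N)
    (k : ℕᵒᵖᵒᵖ) : (lcCocone a i M).ι.app k ≫ (localCohomology a i).map f =
      ((diagram (idealPowersDiagram a) i).obj k).map f ≫ (lcCocone a i N).ι.app k := by
  have := hasColimitDiagram.{u, 0} (idealPowersDiagram a) i
  exact ((colimit.ι (diagram (idealPowersDiagram a) i) k).naturality f).symm

theorem lc_injective_zero {R : Type u} [CommRing R] (a : Ideal R) (I : ModuleCat.{u} R) [Injective I] (n : ℕ) :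
    Subsingleton ((localCohomology a (n+1)).obj I) := by
  refine subsingleton_of_forall_eq 0 fun x => ?_
  obtain ⟨k, y, rfl⟩ := Concrete.isColimit_exists_rep _ (lcIsColimit a (n+1) I) x
  have hz := ext_injective_zero (k.unop.unop |> fun _ => (localCohomology.ringModIdeals (localCohomology.idealPowersDiagram a)).obj k.unop) I n
  have : y = 0 := @Subsingleton.elim _ (ModuleCat.subsingleton_of_isZero hz) _ _
  rw [this]; exact map_zero _

open localCohomology in
theorem lc_delta {R : Type u} [CommRing R] (a : Ideal R) (S : ShortComplex (ModuleCat.{u} R)) (hS : S.ShortExact)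
    [Injective S.X₂] (n : ℕ) :
    ∃ δ : (localCohomology a n).obj S.X₃ ⟶ (localCohomology a (n+1)).obj S.X₁,
      Function.Surjective δ ∧ Function.Exact ((localCohomology a n).map S.g) δ := by
  obtain ⟨δ, hδ⟩ := ext_delta S hS n
  let I := idealPowersDiagram a
  let τ : (diagram I n ⋙ (evaluation _ _).obj S.X₃) ⟶ (diagram I (n+1) ⋙ (evaluation _ _).obj S.X₁) :=
    { app := fun k => δ.app ((ringModIdeals I).op.obj k)
      naturality := fun k l f => δ.naturality ((ringModIdeals I).op.map f) }
  have hτ : ∀ k, Function.Surjective (τ.app k) ∧ Function.Exact (((diagram I n).obj k).map S.g) (τ.app k) :=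
    fun k => hδ _
  clear_value τ
  let D : (lcCocone a n S.X₃).pt ⟶ (lcCocone a (n+1) S.X₁).pt :=
    (lcIsColimit a n S.X₃).map (lcCocone a (n+1) S.X₁) τ
  have hD : ∀ k, (lcCocone a n S.X₃).ι.app k ≫ D = τ.app k ≫ (lcCocone a (n+1) S.X₁).ι.app k :=
    fun k => (lcIsColimit a n S.X₃).ι_map _ τ k
  have hD' : ∀ k x, D ((lcCocone a n S.X₃).ι.app k x) = (lcCocone a (n+1) S.X₁).ι.app k (τ.app k x) :=
    fun k x => ConcreteCategory.congr_hom (hD k) x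
  have hN : ∀ k x, (localCohomology a n).map S.g ((lcCocone a n S.X₂).ι.app k x) =
      (lcCocone a n S.X₃).ι.app k (((diagram I n).obj k).map S.g x) :=
    fun k x => ConcreteCategory.congr_hom (lcCocone_nat a n S.g k) x
  refine ⟨D, ?_, ?_⟩
  · intro x
    obtain ⟨k, y, rfl⟩ := Concrete.isColimit_exists_rep _ (lcIsColimit a (n+1) S.X₁) x
    obtain ⟨z, rfl⟩ := (hτ k).1 y
    exact ⟨(lcCocone a n S.X₃).ι.app k z, hD' k z⟩
  · intro x
    constructor
    · intro hx
      obtain ⟨k, y, rfl⟩ := Concrete.isColimit_exists_rep _ (lcIsColimit a n S.X₃) x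
      have h0 := (hD' k y).symm.trans hx
      have h1 := h0.trans (map_zero ((lcCocone a (n+1) S.X₁).ι.app k).hom).symm
      obtain ⟨l, f, g, e⟩ := (Concrete.isColimit_rep_eq_iff_exists _ (lcIsColimit a (n+1) S.X₁) _ _).1 h1
      have e1 : τ.app l ((diagram I n ⋙ (evaluation _ _).obj S.X₃).map f y) = 0 := by
        have := ConcreteCategory.congr_hom (τ.naturality f) y
        refine this.trans (e.trans (map_zero _))
      obtain ⟨z, hz⟩ := ((hτ l).2 _).1 e1
      refine ⟨(lcCocone a n S.X₂).ι.app l z, (hN l z).trans ?_⟩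
      rw [hz]
      exact ConcreteCategory.congr_hom ((lcCocone a n S.X₃).w f) y
    · rintro ⟨x, rfl⟩
      obtain ⟨k, y, rfl⟩ := Concrete.isColimit_exists_rep _ (lcIsColimit a n S.X₂) x
      have := hN k y
      refine (congrArg D this).trans ((hD' _ _).trans ?_)
      rw [((hτ k).2 _).2 ⟨y, rfl⟩]
      exact map_zero _

theorem fromZero_nat {C D : Type*} [Category* C] [Category* D] [Abelian C]
    [HasProjectiveResolutions C] [Abelian D] {F G : C ⥤ D} [F.Additive] [G.Additive]
    (α : F ⟶ G) (X : C) :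
    (NatTrans.leftDerived α 0).app X ≫ G.fromLeftDerivedZero.app X =
      F.fromLeftDerivedZero.app X ≫ α.app X := by
  let P := projectiveResolution X
  rw [P.leftDerived_app_eq, P.fromLeftDerivedZero_eq, P.fromLeftDerivedZero_eq]
  simp only [Category.assoc, Iso.inv_hom_id_assoc]
  congr 1
  have h1 : (HomologicalComplex.homologyFunctor D (ComplexShape.down ℕ) 0).map
      ((NatTrans.mapHomologicalComplex α _).app P.complex) ≫
      (ChainComplex.isoHomologyι₀ ((G.mapHomologicalComplex _).obj P.complex)).hom =
      (ChainComplex.isoHomologyι₀ ((F.mapHomologicalComplex _).obj P.complex)).hom ≫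
      HomologicalComplex.opcyclesMap ((NatTrans.mapHomologicalComplex α _).app P.complex) 0 := by
    exact HomologicalComplex.homologyι_naturality _ _
  have h2 : HomologicalComplex.opcyclesMap ((NatTrans.mapHomologicalComplex α (ComplexShape.down ℕ)).app P.complex) 0 ≫ P.fromLeftDerivedZero' G
     = P.fromLeftDerivedZero' F ≫ α.app X := by
    rw [← cancel_epi (HomologicalComplex.pOpcycles _ _)]
    rw [HomologicalComplex.p_opcyclesMap_assoc, P.pOpcycles_comp_fromLeftDerivedZero' G, ← Category.assoc, P.pOpcycles_comp_fromLeftDerivedZero' F]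
    exact (α.naturality (P.π.f 0)).symm
  refine (Category.assoc _ _ _).symm.trans ((congrArg (· ≫ _) h1).trans
    ((Category.assoc _ _ _).trans ((congrArg (_ ≫ ·) h2).trans ?_)))
  exact (Category.assoc _ _ _).symm

instance linYon_lim {R : Type u} [CommRing R] (M : ModuleCat.{u} R) :
    PreservesFiniteLimits ((linearYoneda R (ModuleCat.{u} R)).obj M) := by
  have : PreservesFiniteLimits ((linearYoneda R (ModuleCat.{u} R)).obj M ⋙ forget (ModuleCat.{u} R)) := by
    change PreservesFiniteLimits (yoneda.obj M)
    infer_instance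
  exact preservesFiniteLimits_of_reflects_of_preserves _ (forget (ModuleCat.{u} R))

theorem ext0 {R : Type u} [CommRing R] : ∃ θ : ∀ (M : ModuleCat.{u} R), (linearYoneda R (ModuleCat.{u} R)).obj M ⟶
      (Ext R (ModuleCat.{u} R) 0).flip.obj M,
      (∀ M N, Function.Bijective ((θ M).app N)) ∧ 
      ∀ {M M' : ModuleCat.{u} R} (f : M ⟶ M') N, (θ M).app N ≫ ((Ext R (ModuleCat.{u} R) 0).obj N).map f =
        ((linearYoneda R (ModuleCat.{u} R)).map f).app N ≫ (θ M').app N := by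
  have I : ∀ M : ModuleCat.{u} R, PreservesFiniteColimits ((linearYoneda R (ModuleCat.{u} R)).obj M).rightOp :=
    fun M => preservesFiniteColimits_rightOp _
  refine ⟨fun M => NatTrans.leftOp (((linearYoneda R (ModuleCat.{u} R)).obj M).rightOp.fromLeftDerivedZero), ?_, ?_⟩
  · intro M N
    have : IsIso (((linearYoneda R (ModuleCat.{u} R)).obj M).rightOp.fromLeftDerivedZero.app N.unop).unop := inferInstance
    exact ConcreteCategory.bijective_of_isIso (((linearYoneda R (ModuleCat.{u} R)).obj M).rightOp.fromLeftDerivedZero.app N.unop).unop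
  · intro M M' f N
    exact congrArg Quiver.Hom.unop (fromZero_nat (NatTrans.rightOp ((linearYoneda R (ModuleCat.{u} R)).map f)) N.unop)

/-- torsion submodule -/
def Gam {R : Type u} [CommRing R] (a : Ideal R) (M : Type u) [AddCommGroup M] [Module R M] : Submodule R M where
  carrier := {x | ∃ n : ℕ, ∀ r ∈ a ^ n, r • x = 0}
  zero_mem' := ⟨0, by simp⟩
  add_mem' := by
    rintro x y ⟨n, hn⟩ ⟨m, hm⟩
    refine ⟨n + m, fun r hr => ?_⟩
    rw [smul_add, hn r (Ideal.pow_le_pow_right (by omega) hr), hm r (Ideal.pow_le_pow_right (by omega) hr), add_zero]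
  smul_mem' := by
    rintro c x ⟨n, hn⟩
    exact ⟨n, fun r hr => by rw [smul_comm, hn r hr, smul_zero]⟩

open localCohomology in
/-- evaluation at one -/
def ev1 {R : Type u} [CommRing R] (a : Ideal R) (M : ModuleCat.{u} R) (k : ℕᵒᵖᵒᵖ) :
    ((ringModIdeals (idealPowersDiagram a)).op ⋙ (linearYoneda R (ModuleCat.{u} R)).obj M).obj k ⟶ ModuleCat.of R (Gam a M) :=
  ModuleCat.ofHom 
  { toFun := fun (φ : (ringModIdeals (idealPowersDiagram a)).obj k.unop ⟶ M) => 
      ⟨φ.hom (Submodule.Quotient.mk (p := a ^ k.unop.unop) (1 : R)), k.unop.unop, fun r hr => by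
        have h : φ.hom (Submodule.Quotient.mk (p := a ^ k.unop.unop) r) = 0 := by
          rw [(Submodule.Quotient.mk_eq_zero (a ^ k.unop.unop)).2 hr]
          exact map_zero _
        rw [← h]
        have h2 : Submodule.Quotient.mk (p := a ^ k.unop.unop) r = r • Submodule.Quotient.mk (p := a ^ k.unop.unop) (1 : R) := by
          rw [← Submodule.Quotient.mk_smul, smul_eq_mul, mul_one]
        rw [h2]
        exact (map_smul φ.hom r _).symm⟩
    map_add' := fun _ _ => rfl
    map_smul' := fun _ _ => rfl }

open localCohomology in
theorem ev1_val {R : Type u} [CommRing R] (a : Ideal R) (M : ModuleCat.{u} R) (k : ℕᵒᵖᵒᵖ)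
    (φ : (ringModIdeals (idealPowersDiagram a)).obj k.unop ⟶ M) :
    (ev1 a M k φ).1 = φ.hom (Submodule.Quotient.mk (p := a ^ k.unop.unop) (1 : R)) := rfl

open localCohomology in
theorem ev1_inj {R : Type u} [CommRing R] (a : Ideal R) (k : ℕᵒᵖᵒᵖ) (M : ModuleCat.{u} R)
    (φ : ((ringModIdeals (idealPowersDiagram a)).op ⋙ (linearYoneda R (ModuleCat.{u} R)).obj M).obj k)
    (h : ev1 a M k φ = 0) : φ = 0 := by
  change (show (ringModIdeals (idealPowersDiagram a)).obj k.unop ⟶ M from φ) = 0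
  have h := (ev1_val a M k φ).symm.trans (congrArg Subtype.val h)
  apply ModuleCat.hom_ext
  refine Submodule.linearMap_qext (a ^ k.unop.unop) ?_
  ext
  exact h

open localCohomology in
theorem ev1_surj {R : Type u} [CommRing R] (a : Ideal R) (M : ModuleCat.{u} R)
    (x : Gam a M) : ∃ k φ, ev1 a M k φ = x := by
  obtain ⟨x, k, hk⟩ := x
  let ψ : ModuleCat.of R (R ⧸ a ^ k) ⟶ M :=
    ModuleCat.ofHom (Submodule.liftQ _ (LinearMap.toSpanSingleton R M x) fun r hr => hk r hr)
  refine ⟨Opposite.op (Opposite.op k), ψ, ?_⟩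
  apply Subtype.ext
  refine (ev1_val a M (Opposite.op (Opposite.op k)) ψ).trans ?_
  change (1 : R) • x = x
  exact one_smul _ _

open localCohomology in
/-- cocone -/
def evC {R : Type u} [CommRing R] (a : Ideal R) (M : ModuleCat.{u} R) :
   Cocone ((ringModIdeals (idealPowersDiagram a)).op ⋙ (linearYoneda R (ModuleCat.{u} R)).obj M) where
  pt := ModuleCat.of R (Gam a M)
  ι := { app := fun k => ev1 a M k
         naturality := fun k l f => by
          ext φ
          rfl }

open localCohomology in
theorem lc0_aux {R : Type u} [CommRing R] (a : Ideal R) (M : ModuleCat.{u} R)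
    (θ : (linearYoneda R (ModuleCat.{u} R)).obj M ⟶ (Ext R (ModuleCat.{u} R) 0).flip.obj M)
    (hθ : ∀ N, Function.Bijective (θ.app N)) :
    ∃ D : (lcCocone a 0 M).pt ⟶ ModuleCat.of R (Gam a M),
      Function.Bijective D ∧ 
      ∀ k φ, D ((lcCocone a 0 M).ι.app k (θ.app ((ringModIdeals (idealPowersDiagram a)).op.obj k) φ)) = ev1 a M k φ := by
  have : ∀ N, IsIso (θ.app N) := fun N => (ConcreteCategory.isIso_iff_bijective _).2 (hθ N)
  have : IsIso θ := NatIso.isIso_of_isIso_app _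
  let τ : diagram (idealPowersDiagram a) 0 ⋙ (evaluation _ _).obj M ⟶ 
    (ringModIdeals (idealPowersDiagram a)).op ⋙ (linearYoneda R (ModuleCat.{u} R)).obj M := 
    Functor.whiskerLeft _ (inv θ)
  have hτ : ∀ k φ, τ.app k (θ.app ((ringModIdeals (idealPowersDiagram a)).op.obj k) φ) = φ := by
    intro k φ
    have : θ ≫ inv θ = 𝟙 _ := IsIso.hom_inv_id θ
    exact ConcreteCategory.congr_hom (NatTrans.congr_app this ((ringModIdeals (idealPowersDiagram a)).op.obj k)) φ
  clear_value τ
  obtain ⟨D, hD⟩ : ∃ D : (lcCocone a 0 M).pt ⟶ ModuleCat.of R (Gam a M),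
    ∀ k, (lcCocone a 0 M).ι.app k ≫ D = τ.app k ≫ ev1 a M k :=
    ⟨(lcIsColimit a 0 M).desc ((Cocone.precompose τ).obj (evC a M)), (lcIsColimit a 0 M).fac ((Cocone.precompose τ).obj (evC a M))⟩
  have hD2 : ∀ k φ, D ((lcCocone a 0 M).ι.app k (θ.app ((ringModIdeals (idealPowersDiagram a)).op.obj k) φ)) = ev1 a M k φ := by
    intro k φ
    exact (ConcreteCategory.congr_hom (hD k) _).trans (congrArg (ev1 a M k) (hτ k φ))
  refine ⟨D, ⟨?_, ?_⟩, hD2⟩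
  · refine (injective_iff_map_eq_zero D.hom).2 ?_
    intro x hx
    obtain ⟨k, y, rfl⟩ := Concrete.isColimit_exists_rep _ (lcIsColimit a 0 M) x
    obtain ⟨φ, rfl⟩ := (hθ _).2 y
    have h0 := ev1_inj _ _ _ _ ((hD2 k φ).symm.trans hx)
    rw [h0, map_zero]
    exact map_zero _
  · intro x
    obtain ⟨k, φ, rfl⟩ := ev1_surj a M x
    exact ⟨_, hD2 k φ⟩

open localCohomology in
theorem lc0 {R : Type u} [CommRing R] (a : Ideal R) :
    ∃ e : ∀ M : ModuleCat.{u} R, ((localCohomology a 0).obj M) ≃ₗ[R] Gam a M,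
      ∀ (M M' : ModuleCat.{u} R) (f : M ⟶ M') x,
        (e M' ((localCohomology a 0).map f x) : M') = f (e M x : M) := by
  obtain ⟨θ, hθ, hn⟩ := ext0 (R := R)
  choose D hb hD using fun M => lc0_aux a M (θ M) (hθ M)
  refine ⟨fun M => LinearEquiv.ofBijective (D M).hom (hb M), ?_⟩
  intro M M' g x
  obtain ⟨k, y, rfl⟩ := Concrete.isColimit_exists_rep _ (lcIsColimit a 0 M) x
  obtain ⟨φ, rfl⟩ := (hθ M _).2 y
  have h0 := ConcreteCategory.congr_hom (hn g ((ringModIdeals (idealPowersDiagram a)).op.obj k)) φ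
  have h1 : (localCohomology a 0).map g ((lcCocone a 0 M).ι.app k ((θ M).app ((ringModIdeals (idealPowersDiagram a)).op.obj k) φ)) = 
       (lcCocone a 0 M').ι.app k ((θ M').app ((ringModIdeals (idealPowersDiagram a)).op.obj k)
        (((linearYoneda R (ModuleCat.{u} R)).map g).app ((ringModIdeals (idealPowersDiagram a)).op.obj k) φ)) :=
    (ConcreteCategory.congr_hom (lcCocone_nat a 0 g k) _).trans (congrArg ((lcCocone a 0 M').ι.app k) h0)
  have h2 := hD M' k (((linearYoneda R (ModuleCat.{u} R)).map g).app ((ringModIdeals (idealPowersDiagram a)).op.obj k) φ)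
  have h3 := hD M k φ
  refine (congrArg Subtype.val ((congrArg (D M') h1).trans h2)).trans ?_
  refine Eq.trans ?_ (congrArg (fun z => g (Subtype.val z)) h3).symm
  rfl

/-- semilinear localization -/
def IsLoc {R R' : Type u} [CommRing R] [CommRing R'] {σ : R →+* R'} (S : Submonoid R)
    {X Y : Type u} [AddCommGroup X] [AddCommGroup Y] [Module R X] [Module R' Y] (φ : X →ₛₗ[σ] Y) : Prop :=
  (∀ x, φ x = 0 → ∃ s ∈ S, s • x = 0) ∧ (∀ y, ∃ s ∈ S, ∃ x, σ s • y = φ x)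

theorem isLoc_equiv {R R' : Type u} [CommRing R] [CommRing R'] {σ : R →+* R'} (S : Submonoid R)
    {X Y X₁ Y₁ : Type u} [AddCommGroup X] [AddCommGroup Y] [Module R X] [Module R' Y] 
    [AddCommGroup X₁] [AddCommGroup Y₁] [Module R X₁] [Module R' Y₁] (φ : X →ₛₗ[σ] Y) (h : IsLoc S φ)
    (e : X₁ ≃ₗ[R] X) (e' : Y₁ ≃ₗ[R'] Y) : 
    ∃ ψ : X₁ →ₛₗ[σ] Y₁, IsLoc S ψ ∧ ∀ x, e' (ψ x) = φ (e x) := by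
  refine ⟨e'.symm.toLinearMap.comp (φ.comp e.toLinearMap), ⟨?_, ?_⟩, ?_⟩
  · intro x hx
    obtain ⟨s, hs, h0⟩ := h.1 (e x) (by simpa using hx)
    exact ⟨s, hs, by simpa [← map_smul] using h0⟩
  · intro y
    obtain ⟨s, hs, x, h0⟩ := h.2 (e' y)
    refine ⟨s, hs, e.symm x, ?_⟩
    apply e'.injective
    simpa using h0
  · intro x
    simp

theorem isLoc_coker {R R' : Type u} [CommRing R] [CommRing R'] {σ : R →+* R'} (S : Submonoid R)
    {A B X A' B' Y : Type u} [AddCommGroup X] [AddCommGroup Y] [Module R X] [Module R' Y] 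
    [AddCommGroup A] [AddCommGroup A'] [Module R A] [Module R' A'] 
    [AddCommGroup B] [AddCommGroup B'] [Module R B] [Module R' B'] 
    (f : A →ₗ[R] B) (g : B →ₗ[R] X) (f' : A' →ₗ[R'] B') (g' : B' →ₗ[R'] Y)
    (hg : Function.Surjective g) (hg' : Function.Surjective g')
    (he : Function.Exact f g) (he' : Function.Exact f' g')
    (φA : A →ₛₗ[σ] A') (φB : B →ₛₗ[σ] B') (hA : IsLoc S φA) (hB : IsLoc S φB)
    (hc : ∀ x, φB (f x) = f' (φA x)) : 
    ∃ ψ : X →ₛₗ[σ] Y, IsLoc S ψ := by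
  have key : ∀ b₁ b₂, g b₁ = g b₂ → g' (φB b₁) = g' (φB b₂) := by
    intro b₁ b₂ h
    obtain ⟨x, hx⟩ := (he (b₁ - b₂)).1 (by rw [map_sub, h, sub_self])
    rw [← sub_eq_zero, ← map_sub, ← map_sub, ← hx, hc]
    exact (he' _).2 ⟨_, rfl⟩
  let r := Function.surjInv hg
  have hr : ∀ x, g (r x) = x := Function.surjInv_eq hg
  let ψ : X →ₛₗ[σ] Y := 
    { toFun := fun x => g' (φB (r x))
      map_add' := fun x y => by
        rw [← map_add, ← map_add]
        exact key _ _ (by simp [hr])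
      map_smul' := fun c x => by
        rw [← map_smul, ← map_smulₛₗ]
        exact key _ _ (by simp [hr]) }
  have hψ : ∀ b, ψ (g b) = g' (φB b) := fun b => key _ _ (hr _)
  refine ⟨ψ, ?_, ?_⟩
  · intro x hx
    obtain ⟨b, rfl⟩ := hg x
    rw [hψ] at hx
    obtain ⟨a', ha'⟩ := (he' _).1 hx
    obtain ⟨s, hs, x, hx⟩ := hA.2 a'
    obtain ⟨t, ht, h0⟩ := hB.1 (s • b - f x) (by
      rw [map_sub, map_smulₛₗ, hc, ← hx, map_smul, ha', sub_self])
    refine ⟨t * s, S.mul_mem ht hs, ?_⟩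
    have := congrArg g h0
    rw [map_smul, map_sub, (he _).2 ⟨_, rfl⟩, sub_zero, map_smul, map_zero] at this
    rw [mul_smul, this]
  · intro y
    obtain ⟨b, rfl⟩ := hg' y
    obtain ⟨s, hs, x, hx⟩ := hB.2 b
    exact ⟨s, hs, g x, by rw [hψ, ← hx, map_smul]⟩

theorem common_kill {R : Type u} [CommRing R] (S : Submonoid R) {X : Type u} [AddCommGroup X] [Module R X]
    (x : X) (J : Ideal R) (hJ : J.FG) (h : ∀ r ∈ J, ∃ s ∈ S, s • r • x = 0) :
    ∃ s ∈ S, ∀ r ∈ J, s • r • x = 0 := by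
  induction J, hJ using Submodule.fg_induction with
  | singleton g =>
    obtain ⟨s, hs, h0⟩ := h g (Submodule.mem_span_singleton_self g)
    refine ⟨s, hs, fun r hr => ?_⟩
    obtain ⟨c, rfl⟩ := Submodule.mem_span_singleton.1 hr
    rw [smul_assoc, smul_comm, h0, smul_zero]
  | sup J₁ J₂ _ _ h₁ h₂ =>
    obtain ⟨s, hs, h1⟩ := h₁ fun r hr => h r (Submodule.mem_sup_left hr)
    obtain ⟨t, ht, h2⟩ := h₂ fun r hr => h r (Submodule.mem_sup_right hr)
    refine ⟨s * t, S.mul_mem hs ht, fun r hr => ?_⟩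
    obtain ⟨y, hy, z, hz, rfl⟩ := Submodule.mem_sup.1 hr
    rw [add_smul, smul_add, mul_comm, mul_smul, h1 y hy, mul_comm, mul_smul, h2 z hz, smul_zero, smul_zero, add_zero]

theorem isLoc_gam {R R' : Type u} [CommRing R] [IsNoetherianRing R] [CommRing R'] {σ : R →+* R'} (S : Submonoid R)
    (a : Ideal R)
    {X Y : Type u} [AddCommGroup X] [AddCommGroup Y] [Module R X] [Module R' Y] (φ : X →ₛₗ[σ] Y) (h : IsLoc S φ) :
    ∃ ψ : Gam a X →ₛₗ[σ] Gam (a.map σ) Y, IsLoc S ψ ∧ ∀ x, (ψ x : Y) = φ x := by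
  let ψ : Gam a X →ₛₗ[σ] Gam (a.map σ) Y :=
    { toFun := fun x => ⟨φ x, by
        obtain ⟨x, n, hn⟩ := x
        refine ⟨n, ?_⟩
        have : (a.map σ) ^ n ≤ LinearMap.ker (LinearMap.toSpanSingleton R' Y (φ x)) := by
          rw [← Ideal.map_pow, Ideal.map_le_iff_le_comap]
          intro r hr
          change σ r • φ x = 0
          rw [← map_smulₛₗ, hn r hr, map_zero]
        exact fun r hr => this hr⟩
      map_add' := fun x y => Subtype.ext (map_add φ _ _)
      map_smul' := fun x y => Subtype.ext (map_smulₛₗ φ _ _) }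
  refine ⟨ψ, ⟨?_, ?_⟩, fun x => rfl⟩
  · intro x hx
    obtain ⟨s, hs, h0⟩ := h.1 x (congrArg Subtype.val hx)
    exact ⟨s, hs, Subtype.ext h0⟩
  · rintro ⟨y, n, hn⟩
    obtain ⟨s, hs, x, hx⟩ := h.2 y
    obtain ⟨t, ht, h0⟩ := common_kill S x (a ^ n) (IsNoetherian.noetherian _) (fun r hr => by
      apply h.1
      rw [map_smulₛₗ, ← hx, smul_comm, hn, smul_zero]
      rw [← Ideal.map_pow]
      exact Ideal.mem_map_of_mem _ hr)
    refine ⟨t * s, S.mul_mem ht hs, ⟨t • x, n, fun r hr => by rw [smul_comm, h0 r hr]⟩, ?_⟩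
    apply Subtype.ext
    change σ (t * s) • y = φ (t • x)
    rw [map_smulₛₗ, ← hx, map_mul, mul_smul]

/-- localization as semilinear -/
noncomputable def mkS {R : Type u} [CommRing R] (S : Submonoid R) (M : Type u) [AddCommGroup M] [Module R M] :
    M →ₛₗ[algebraMap R (Localization S)] LocalizedModule S M where
  toFun := LocalizedModule.mkLinearMap S M
  map_add' := map_add _
  map_smul' r x := by rw [map_smul, algebraMap_smul]

theorem isLoc_mkS {R : Type u} [CommRing R] (S : Submonoid R) (M : Type u) [AddCommGroup M] [Module R M] :
    IsLoc S (mkS S M) := by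
  constructor
  · intro x hx
    obtain ⟨s, hs⟩ := (IsLocalizedModule.eq_zero_iff S (LocalizedModule.mkLinearMap S M)).1 hx
    exact ⟨s, s.2, hs⟩
  · intro y
    obtain ⟨⟨x, s⟩, hx⟩ := IsLocalizedModule.surj S (LocalizedModule.mkLinearMap S M) y
    refine ⟨s, s.2, x, ?_⟩
    rw [algebraMap_smul]
    exact hx

theorem isLoc_lc0 {R : Type u} [CommRing R] [IsNoetherianRing R] (S : Submonoid R) (a : Ideal R) :
    ∃ φ : ∀ (M : Type u) [AddCommGroup M] [Module R M], 
      (localCohomology a 0).obj (ModuleCat.of R M) →ₛₗ[algebraMap R (Localization S)]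
       (localCohomology (a.map (algebraMap R (Localization S))) 0).obj (ModuleCat.of (Localization S) (LocalizedModule S M)),
      (∀ (M : Type u) [AddCommGroup M] [Module R M], IsLoc S (φ M)) ∧
      (∀ (M N : Type u) [AddCommGroup M] [Module R M] [AddCommGroup N] [Module R N] (f : M →ₗ[R] N) x,
        φ N ((localCohomology a 0).map (ModuleCat.ofHom f) x) = 
          (localCohomology (a.map (algebraMap R (Localization S))) 0).map (ModuleCat.ofHom (LocalizedModule.map S f)) (φ M x)) := by
  obtain ⟨e, he⟩ := lc0 a
  obtain ⟨e', he'⟩ := lc0 (a.map (algebraMap R (Localization S)))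
  choose ψ hψ hψ2 using fun (M : Type u) [AddCommGroup M] [Module R M] => isLoc_gam S a (mkS S M) (isLoc_mkS S M)
  choose φ hφ hφ2 using fun (M : Type u) [AddCommGroup M] [Module R M] =>
    isLoc_equiv S (ψ M) (hψ M) (e (ModuleCat.of R M)) (e' (ModuleCat.of (Localization S) (LocalizedModule S M)))
  refine ⟨φ, fun M => hφ M, fun M N _ _ _ _ f x => ?_⟩
  apply (e' _).injective
  apply Subtype.ext
  have h1 := congrArg Subtype.val (hφ2 N ((localCohomology a 0).map (ModuleCat.ofHom f) x))
  have h2 := he (ModuleCat.of R M) (ModuleCat.of R N) (ModuleCat.ofHom f) x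
  have h3 := he' _ _ (ModuleCat.ofHom (LocalizedModule.map S f)) (φ M x)
  have h4 := congrArg Subtype.val (hφ2 M x)
  refine h1.trans ((hψ2 N _).trans ((congrArg (mkS S N) h2).trans ?_))
  refine Eq.trans ?_ (h3.trans (congrArg (LocalizedModule.map S f) (h4.trans (hψ2 M _)))).symm
  exact (LocalizedModule.map_mk S f _ 1).symm

theorem loc_inj {R : Type u} [CommRing R] [IsNoetherianRing R] (S : Submonoid R) (I : ModuleCat.{u} R)
    [hI : Injective I] : Injective (ModuleCat.of (Localization S) (LocalizedModule S I)) := by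
  have : Module.Injective R I := (Module.injective_iff_injective_object R I).2 hI
  have := Module.injective_of_isLocalizedModule S (Rₛ := Localization S) (LocalizedModule.mkLinearMap S I)
  exact Module.injective_object_of_injective_module _ _

theorem isLoc_lc {R : Type u} [CommRing R] [IsNoetherianRing R] (S : Submonoid R) (a : Ideal R) (n : ℕ) 
    (M : Type u) [AddCommGroup M] [Module R M] : 
    ∃ φ : (localCohomology a n).obj (ModuleCat.of R M) →ₛₗ[algebraMap R (Localization S)]
       (localCohomology (a.map (algebraMap R (Localization S))) n).obj (ModuleCat.of (Localization S) (LocalizedModule S M)),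
      IsLoc S φ := by
  obtain ⟨φ, hφ, hnat⟩ := isLoc_lc0 S a
  induction n generalizing M with
  | zero => exact ⟨φ M, hφ M⟩
  | succ n ih =>
    obtain ⟨I, C, f, g, hf, hg, hfg, hI⟩ : ∃ (I C : ModuleCat.{u} R) (f : M →ₗ[R] I) (g : I →ₗ[R] C),
        Function.Injective f ∧ Function.Surjective g ∧ Function.Exact f g ∧ Injective I := by
      refine ⟨Injective.under (ModuleCat.of R M), ModuleCat.of R (_ ⧸ LinearMap.range (Injective.ι (ModuleCat.of R M)).hom), (Injective.ι (ModuleCat.of R M)).hom, Submodule.mkQ _, ?_, Submodule.mkQ_surjective _, ?_, inferInstance⟩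
      · exact (ModuleCat.mono_iff_injective (Injective.ι (ModuleCat.of R M))).1 inferInstance
      · exact LinearMap.exact_map_mkQ_range _
    have hI' := loc_inj S I
    have hfg' : Function.Exact (LocalizedModule.map S f) (LocalizedModule.map S g) :=
      LocalizedModule.map_exact S f g hfg
    have hf' := LocalizedModule.map_injective S f hf
    have hg' := LocalizedModule.map_surjective S g hg
    obtain ⟨δ, d1, d2⟩ := lc_delta a (ShortComplex.mk (ModuleCat.ofHom f) (ModuleCat.ofHom g) (by
      ext x; exact hfg.apply_apply_eq_zero x)) 
      { exact := ModuleCat.shortComplex_exact _ hfg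
        mono_f := (ModuleCat.mono_iff_injective _).2 hf
        epi_g := (ModuleCat.epi_iff_surjective _).2 hg } n
    obtain ⟨δ', d1', d2'⟩ := lc_delta (a.map (algebraMap R (Localization S))) (ShortComplex.mk 
      (ModuleCat.ofHom (LocalizedModule.map S f)) (ModuleCat.ofHom (LocalizedModule.map S g)) (by
      apply ModuleCat.hom_ext
      ext x; exact hfg'.apply_apply_eq_zero x)) 
      { exact := ModuleCat.shortComplex_exact _ hfg'
        mono_f := (ModuleCat.mono_iff_injective _).2 hf'
        epi_g := (ModuleCat.epi_iff_surjective _).2 hg' } n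
    cases n with
    | zero => exact isLoc_coker S _ δ.hom _ δ'.hom d1 d1' d2 d2' (φ I) (φ C) (hφ I) (hφ C) (hnat I C g)
    | succ n =>
      obtain ⟨φC, hC⟩ := ih C
      have s1 := lc_injective_zero a I n
      have s2 := lc_injective_zero (a.map (algebraMap R (Localization S))) (ModuleCat.of (Localization S) (LocalizedModule S I)) n
      refine isLoc_coker S _ δ.hom _ δ'.hom d1 d1' d2 d2' 0 φC ⟨fun x _ => ⟨1, S.one_mem, ?_⟩, fun y => ⟨1, S.one_mem, 0, ?_⟩⟩ hC ?_
      · exact @Subsingleton.elim _ s1 _ _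
      · exact @Subsingleton.elim _ s2 _ _
      · intro x
        have : x = 0 := @Subsingleton.elim _ s1 _ _
        rw [this, map_zero, map_zero, map_zero, map_zero]

theorem kill_loc {R : Type u} [CommRing R] [IsNoetherianRing R] (P : Ideal R) [P.IsPrime] (a b : Ideal R) (i n : ℕ)
    (M : Type u) [AddCommGroup M] [Module R M]
    (h : b ^ n • (⊤ : Submodule R (locH R a i M)) = ⊥) :
    (b.map (algebraMap R (Localization.AtPrime P))) ^ n • (⊤ : Submodule (Localization.AtPrime P)
      (locH (Localization.AtPrime P) (a.map (algebraMap R (Localization.AtPrime P))) i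
        (LocalizedModule P.primeCompl M))) = ⊥ := by
  obtain ⟨φ, hφ⟩ := isLoc_lc P.primeCompl a i M
  rw [eq_bot_iff, Submodule.smul_le]
  intro r hr y _
  have key : (b.map (algebraMap R (Localization.AtPrime P))) ^ n ≤
      LinearMap.ker (LinearMap.toSpanSingleton (Localization.AtPrime P) _ y) := by
    rw [← Ideal.map_pow, Ideal.map_le_iff_le_comap]
    intro r hr
    change algebraMap R (Localization.AtPrime P) r • y = 0
    obtain ⟨s, hs, x, hx⟩ := hφ.2 y
    have hu : IsUnit (algebraMap R (Localization.AtPrime P) s) :=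
      IsLocalization.map_units (Localization.AtPrime P) (⟨s, hs⟩ : P.primeCompl)
    have h0 : r • x = 0 := by
      have := Submodule.smul_mem_smul hr (Submodule.mem_top (x := x))
      exact (Submodule.mem_bot R).1 (h ▸ this)
    refine (hu.smul_eq_zero).1 ?_
    rw [smul_comm]
    refine (congrArg _ hx).trans ((map_smulₛₗ φ r x).symm.trans ?_)
    rw [h0, map_zero]
    rfl
  exact (Submodule.mem_bot _).2 (key hr)

theorem kill_glob {R : Type u} [CommRing R] [IsNoetherianRing R] (a b : Ideal R) (i n : ℕ)
    (M : Type u) [AddCommGroup M] [Module R M]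
    (h : ∀ (P : Ideal R) [P.IsPrime], P ∈ associatedPrimes R (locH R a i M) →
    (b.map (algebraMap R (Localization.AtPrime P))) ^ n • (⊤ : Submodule (Localization.AtPrime P)
      (locH (Localization.AtPrime P) (a.map (algebraMap R (Localization.AtPrime P))) i
        (LocalizedModule P.primeCompl M))) = ⊥) :
    b ^ n • (⊤ : Submodule R (locH R a i M)) = ⊥ := by
  rw [eq_bot_iff, Submodule.smul_le]
  intro r hr x _
  rw [Submodule.mem_bot]
  by_contra hne
  obtain ⟨P, hP, hle⟩ := exists_le_isAssociatedPrime_of_isNoetherianRing R (r • x) hne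
  have hprime := hP.isPrime
  have h0 := h P hP
  obtain ⟨φ, hφ⟩ := isLoc_lc P.primeCompl a i M
  obtain ⟨s, hs, h1⟩ := hφ.1 (r • x) (by
    refine (map_smulₛₗ φ r x).trans ?_
    have hm : algebraMap R (Localization.AtPrime P) r ∈ (b.map (algebraMap R (Localization.AtPrime P))) ^ n := by
      rw [← Ideal.map_pow]
      exact Ideal.mem_map_of_mem _ hr
    have := Submodule.smul_mem_smul hm (Submodule.mem_top (x := φ x))
    exact (Submodule.mem_bot _).1 (h0 ▸ this))
  exact hs (hle (by rw [Submodule.mem_colon_singleton]; exact (Submodule.mem_bot R).2 h1))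


end Helpers

/-- if `Ass_R(H_a^{f_a^b(M)}(M))` is finite, then
`f_a^b(M) = inf{f_{aR_p}^{bR_p}(M_p) : p ∈ Spec R}`. -/
theorem fab_eq_inf_localizations (R : Type u) [CommRing R] [IsNoetherianRing R]
    (a b : Ideal R) (hba : b ≤ a)
    (M : Type u) [AddCommGroup M] [Module R M] [Module.Finite R M]
    (hfin : ∀ i : ℕ, fab R a b M = (i : ℕ∞) →
      (associatedPrimes R (locH R a i M)).Finite) :
    fab R a b M = sInf {d : ℕ∞ | ∃ p : PrimeSpectrum R,
      d = fab (Localization.AtPrime p.asIdeal)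
        (a.map (algebraMap R (Localization.AtPrime p.asIdeal)))
        (b.map (algebraMap R (Localization.AtPrime p.asIdeal)))
        (LocalizedModule p.asIdeal.primeCompl M)} := by
  apply le_antisymm
  · refine le_sInf ?_
    rintro d ⟨p, rfl⟩
    refine le_sInf ?_
    rintro _ ⟨i, hi, rfl⟩
    refine sInf_le ⟨i, fun n hn => hi n ?_, rfl⟩
    exact kill_loc p.asIdeal a b i n M hn
  · by_contra! hlt
    have hne : ({i : ℕ | ∀ n : ℕ, b ^ n • (⊤ : Submodule R (locH R a i M)) ≠ ⊥}).Nonempty := by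
      by_contra! he
      have : fab R a b M = ⊤ := by rw [fab, he, Set.image_empty, sInf_empty]
      rw [this] at hlt
      exact not_top_lt hlt
    obtain ⟨i, hi, hif⟩ := csInf_mem (hne.image ((↑) : ℕ → ℕ∞))
    have hif : fab R a b M = (i : ℕ∞) := hif.symm
    have hfi := hfin i hif
    have hex : ∀ P : Ideal R, ∃ n : ℕ, ∀ [P.IsPrime],
        (b.map (algebraMap R (Localization.AtPrime P))) ^ n • (⊤ : Submodule (Localization.AtPrime P)
          (locH (Localization.AtPrime P) (a.map (algebraMap R (Localization.AtPrime P))) i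
            (LocalizedModule P.primeCompl M))) = ⊥ := by
      intro P
      by_cases hP : P.IsPrime
      · by_contra! hcon
        have h1 := sInf_le (a := fab (Localization.AtPrime P) (a.map (algebraMap R (Localization.AtPrime P)))
          (b.map (algebraMap R (Localization.AtPrime P))) (LocalizedModule P.primeCompl M))
          (s := {d : ℕ∞ | ∃ p : PrimeSpectrum R,
            d = fab (Localization.AtPrime p.asIdeal)
            (a.map (algebraMap R (Localization.AtPrime p.asIdeal)))
            (b.map (algebraMap R (Localization.AtPrime p.asIdeal)))
            (LocalizedModule p.asIdeal.primeCompl M)}) ⟨⟨P, hP⟩, rfl⟩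
        have h2 : fab (Localization.AtPrime P) (a.map (algebraMap R (Localization.AtPrime P)))
          (b.map (algebraMap R (Localization.AtPrime P))) (LocalizedModule P.primeCompl M) ≤ (i : ℕ∞) :=
          sInf_le ⟨i, fun n => (hcon n).2, rfl⟩
        rw [hif] at hlt
        exact absurd (hlt.trans_le (h1.trans h2)) (lt_irrefl _)
      · exact ⟨0, fun {h} => absurd h hP⟩
    choose N hN using hex
    obtain ⟨n, hn⟩ := (hfi.image N).bddAbove
    refine hi n (kill_glob a b i n M fun P _ hP => ?_)
    rw [eq_bot_iff, ← hN P]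
    exact Submodule.smul_mono_left (Ideal.pow_le_pow_right (hn ⟨P, hP, rfl⟩))
end
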